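/- Let 0 < β < 1, p(n) = n^{−β}, α = min(1/2, β/(2−β)), let k ≥ 1 be an integer and ε > 0. For each n fix a total order on the potential edges of a graph on {1,…,n}. Then there exists B₀ > 0 such that for every B ≥ B₀, lim_{n→∞} P( 2^{ℓ−ε}·binom(E(X_E),ℓ) − B·E(X_E)^{ℓ−α} ≤ f_{ℓ−1}(G) ≤ 2^{ℓ+ε}·binom(E(X_E),ℓ) for all 1 ≤ ℓ ≤ k ) = 1 for G ∈ G(n,p(n)), where binom(x,ℓ) = x(x−1)⋯(x−ℓ+1)/ℓ! for real x. In particular, there exist constants 0 < c < C such that lim_{n→∞} P( c·n^{(2−β)ℓ} ≤ f_{ℓ−1}(G) ≤ C·n^{(2−β)ℓ} for all 1 ≤ ℓ ≤ k ) = 1. -/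

import Mathlib

open SimpleGraph Finset Filter

namespace SEP

/-- The vector `e_i - e_j` in `ℝ^n`. -/
def eVec {n : ℕ} (i j : Fin n) : Fin n → ℝ :=
  fun t => (if t = i then 1 else 0) - (if t = j then 1 else 0)

/-- The symmetric edge polytope of a graph on `Fin n`. -/
def symEdgePolytope {n : ℕ} (G : SimpleGraph (Fin n)) : Set (Fin n → ℝ) :=
  convexHull ℝ {x | ∃ i j, G.Adj i j ∧ x = eVec i j}

/-- Both darts `a` and `b` are arcs of a common directed cycle of length `m` of `G`. -/
def dartsInCycle {V : Type*} (G : SimpleGraph V) (a b : G.Dart) (m : ℕ) : Prop :=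
  ∃ (u : V) (w : G.Walk u u), w.IsCycle ∧ w.length = m ∧ a ∈ w.darts ∧ b ∈ w.darts

/-- `F` is a face of the polytope `P`: the set of maximizers of some linear functional. -/
def IsFaceOfPolytope {n : ℕ} (P F : Set (Fin n → ℝ)) : Prop :=
  ∃ a : Fin n → ℝ,
    F = {x | x ∈ P ∧ ∀ y ∈ P, ∑ t, a t * y t ≤ ∑ t, a t * x t}

/-- Dimension of (the affine span of) a subset of `ℝ^n`. -/
noncomputable def polyDim {n : ℕ} (s : Set (Fin n → ℝ)) : ℕ :=
  Module.finrank ℝ (vectorSpan ℝ s)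

/-- `v` is a vertex of the polytope `P`. -/
def IsVertexOfPolytope {n : ℕ} (P : Set (Fin n → ℝ)) (v : Fin n → ℝ) : Prop :=
  IsFaceOfPolytope P {v}

/-- `F` is an edge (a 1-dimensional face) of the polytope `P`. -/
def IsEdgeOfPolytope {n : ℕ} (P F : Set (Fin n → ℝ)) : Prop :=
  IsFaceOfPolytope P F ∧ polyDim F = 1

/-- A polytope is simple if every vertex lies on exactly `dim P` edges. -/
def IsSimplePolytope {n : ℕ} (P : Set (Fin n → ℝ)) : Prop :=
  ∀ v, IsVertexOfPolytope P v →
    Set.ncard {F : Set (Fin n → ℝ) | IsEdgeOfPolytope P F ∧ v ∈ F} = polyDim P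

/-- Two disjoint edges, on four vertices. -/
def twoDisjointEdges : SimpleGraph (Fin 4) :=
  SimpleGraph.fromEdgeSet {s(0, 1), s(2, 3)}

/-- The cyclomatic number `|E| - |V| + c` of a graph, as an integer. -/
noncomputable def cyc {V : Type*} (G : SimpleGraph V) : ℤ :=
  (G.edgeSet.ncard : ℤ) + Nat.card G.ConnectedComponent - Nat.card V

/-- A graph is 2-connected: connected, with at least 3 vertices, and deleting any
single vertex leaves it connected. -/
def TwoConnected {V : Type*} (G : SimpleGraph V) : Prop :=
  G.Connected ∧ 3 ≤ Nat.card V ∧ ∀ v : V, (G.induce {u | u ≠ v}).Connected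

/-- The subgraph `H` consists of a single edge of `G`. -/
def IsSingleEdge {V : Type*} (G : SimpleGraph V) (H : G.Subgraph) : Prop :=
  ∃ (u v : V) (h : G.Adj u v), H = G.subgraphOfAdj h

/-- `H` is a 2-connected component (block) of `G`: an inclusion-maximal subgraph that is
2-connected or a single edge. -/
def IsBlock {V : Type*} (G : SimpleGraph V) (H : G.Subgraph) : Prop :=
  (TwoConnected H.coe ∨ IsSingleEdge G H) ∧
    ∀ H' : G.Subgraph, H ≤ H' → (TwoConnected H'.coe ∨ IsSingleEdge G H') → H' = H

/-- A pair of darts (oriented edges) of `G`, with distinct underlying edges, is *bad*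
with respect to the order `elt` on edges. -/
def BadPair {V : Type*} (G : SimpleGraph V) (elt : Sym2 V → Sym2 V → Prop)
    (a b : G.Dart) : Prop :=
  a.edge ≠ b.edge ∧
    (dartsInCycle G a b 3 ∨
      ∃ (u : V) (w : G.Walk u u), w.IsCycle ∧ w.length = 4 ∧ a ∈ w.darts ∧ b ∈ w.darts ∧
        (∃ e ∈ w.edges, elt e a.edge) ∧ (∃ e ∈ w.edges, elt e b.edge))

/-- `n₁(G, <)`: the number of (unordered) bad pairs of oriented edges. -/
noncomputable def n1 {V : Type*} (G : SimpleGraph V) (elt : Sym2 V → Sym2 V → Prop) : ℕ :=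
  Set.ncard {z : Sym2 G.Dart | ∃ a b, BadPair G elt a b ∧ z = s(a, b)}

/-- `γ₂(G, <) = 2 cy(G)(cy(G)+2) - n₁(G, <)`. -/
noncomputable def gammaTwo {V : Type*} (G : SimpleGraph V)
    (elt : Sym2 V → Sym2 V → Prop) : ℤ :=
  2 * cyc G * (cyc G + 2) - (n1 G elt : ℤ)

/-- Restriction of an order on `Sym2 V` to `Sym2 s` for `s : Set V`. -/
def restrictOrd {V : Type*} (elt : Sym2 V → Sym2 V → Prop) (s : Set V) :
    Sym2 s → Sym2 s → Prop :=
  fun e₁ e₂ => elt (e₁.map Subtype.val) (e₂.map Subtype.val)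

/-- The graph `G_n` on `Fin n`: vertices `0` and `1` are adjacent to everything. -/
def GnGraph (n : ℕ) : SimpleGraph (Fin n) :=
  SimpleGraph.fromRel (fun a _ => a.val < 2)

/-- The complete bipartite graph `K_{2, n-2}` on `Fin n`, with parts `{0,1}` and the rest. -/
def K2Graph (n : ℕ) : SimpleGraph (Fin n) :=
  SimpleGraph.fromRel (fun a b => a.val < 2 ∧ 2 ≤ b.val)

/-- A set `S` of darts of `G` is a face of the triangulation `Δ_<` of `∂P_G`. -/
def IsFace {V : Type*} (G : SimpleGraph V) (elt : Sym2 V → Sym2 V → Prop)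
    (S : Set G.Dart) : Prop :=
  (¬ ∃ d ∈ S, d.symm ∈ S) ∧
    ∀ ℓ : ℕ, 2 ≤ ℓ → ∀ (u : V) (w : G.Walk u u), w.IsCycle →
      (w.length = 2 * ℓ - 1 → Set.ncard {d ∈ S | d ∈ w.darts} < ℓ) ∧
      (w.length = 2 * ℓ →
        Set.ncard {d ∈ S | d ∈ w.darts ∧ ∃ e ∈ w.edges, elt e d.edge} < ℓ)

/-- The face complex `Δ_<` of `(G, <)`. -/
def faceCx {V : Type*} (G : SimpleGraph V) (elt : Sym2 V → Sym2 V → Prop) :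
    Set (Set G.Dart) :=
  {S | IsFace G elt S}

/-- The join of two simplicial complexes (given as families of faces on disjoint
vertex types). -/
def joinCx {A B : Type*} (F : Set (Set A)) (H : Set (Set B)) : Set (Set (A ⊕ B)) :=
  {S | ∃ F₁ ∈ F, ∃ H₁ ∈ H, S = Sum.inl '' F₁ ∪ Sum.inr '' H₁}

/-- The complex consisting of two disjoint vertices. -/
def twoPtCx : Set (Set (Fin 2)) :=
  {S | S = ∅ ∨ S = {0} ∨ S = {1}}

/-- Contraction of the edge `{v, w}` of a simplicial complex; `v` is identified with `w`. -/
def contractCx {A : Type*} (F : Set (Set A)) (v w : A) : Set (Set A) :=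
  {S | (S ∈ F ∧ v ∉ S) ∨ ∃ H ∈ F, v ∈ H ∧ S = (H \ {v}) ∪ {w}}

/-- Isomorphism of simplicial complexes: a bijection of vertex sets inducing a bijection
of faces. -/
def CxIso {A B : Type*} (F : Set (Set A)) (H : Set (Set B)) : Prop :=
  ∃ φ : A → B, Set.BijOn φ (⋃₀ F) (⋃₀ H) ∧
    (∀ S ∈ F, φ '' S ∈ H) ∧ (∀ T ∈ H, ∃ S ∈ F, φ '' S = T)

/-! ### Erdős–Rényi random graphs -/

/-- The probability weight of a fixed graph `G` in the Erdős–Rényi model `G(n,p)`. -/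
noncomputable def graphWeight (n : ℕ) (p : ℝ) (G : SimpleGraph (Fin n)) : ℝ :=
  p ^ G.edgeSet.ncard * (1 - p) ^ (n.choose 2 - G.edgeSet.ncard)

/-- The probability of an event `A` in the Erdős–Rényi model `G(n,p)`. -/
noncomputable def erProb (n : ℕ) (p : ℝ) (A : Set (SimpleGraph (Fin n))) : ℝ :=
  ∑ G : SimpleGraph (Fin n), A.indicator (graphWeight n p) G

/-- The expectation of a random variable in the Erdős–Rényi model `G(n,p)`. -/
noncomputable def erExp (n : ℕ) (p : ℝ) (X : SimpleGraph (Fin n) → ℝ) : ℝ :=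
  ∑ G : SimpleGraph (Fin n), graphWeight n p G * X G

/-- The variance of a random variable in the Erdős–Rényi model `G(n,p)`. -/
noncomputable def erVar (n : ℕ) (p : ℝ) (X : SimpleGraph (Fin n) → ℝ) : ℝ :=
  erExp n p (fun G => (X G - erExp n p X) ^ 2)

/-- The number of cycles of `G` with exactly `k` vertices, counted via their edge sets. -/
noncomputable def numCycles {V : Type*} (G : SimpleGraph V) (k : ℕ) : ℕ :=
  Set.ncard {s : Set (Sym2 V) |
    ∃ (u : V) (w : G.Walk u u), w.IsCycle ∧ w.length = k ∧ s = {e | e ∈ w.edges}}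

/-- `E(X_k) = C(n,k)·((k−1)!/2)·p^k`, the expected number of `k`-cycles. -/
noncomputable def expCycles (n : ℕ) (p : ℝ) (k : ℕ) : ℝ :=
  (n.choose k : ℝ) * ((Nat.factorial (k - 1) : ℝ) / 2) * p ^ k

/-- `E(X_E) = C(n,2)·p`, the expected number of edges. -/
noncomputable def expEdges (n : ℕ) (p : ℝ) : ℝ :=
  (n.choose 2 : ℝ) * p

/-- `n_{k-1}(G)`: the number of `k`-element non-faces of `Δ_<` containing no antipodal
pair. -/
noncomputable def numNonFaces {V : Type*} (G : SimpleGraph V)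
    (elt : Sym2 V → Sym2 V → Prop) (k : ℕ) : ℕ :=
  Set.ncard {S : Set G.Dart |
    S.ncard = k ∧ (¬ ∃ d ∈ S, d.symm ∈ S) ∧ ¬ IsFace G elt S}

/-- `f_{k-1}(G)`: the number of `k`-element faces of `Δ_<`. -/
noncomputable def numFaces {V : Type*} (G : SimpleGraph V)
    (elt : Sym2 V → Sym2 V → Prop) (k : ℕ) : ℕ :=
  Set.ncard {S : Set G.Dart | S.ncard = k ∧ IsFace G elt S}

/-- The generalized binomial coefficient `binom(x, ℓ)` for real `x`. -/
noncomputable def realChoose (x : ℝ) (ℓ : ℕ) : ℝ :=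
  (∏ i ∈ Finset.range ℓ, (x - i)) / (Nat.factorial ℓ)

/-- The recursively defined γ-numbers `γ_ℓ(G)`:
`γ_0 = 1` and
`γ_ℓ = f_{ℓ−1} − [t^{n−1−ℓ}] ∑_{i<ℓ} γ_i (t+1)^i (t+2)^{n−1−2i}`. -/
noncomputable def gammaRG (n : ℕ) (G : SimpleGraph (Fin n))
    (elt : Sym2 (Fin n) → Sym2 (Fin n) → Prop) : ℕ → ℤ := fun ℓ =>
  Nat.strongRecOn ℓ (fun ℓ ih =>
    if ℓ = 0 then (1 : ℤ)
    else
      (numFaces G elt ℓ : ℤ) -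
        Polynomial.coeff
          (∑ i ∈ (Finset.range ℓ).attach,
            Polynomial.C (ih i.1 (Finset.mem_range.mp i.2)) *
              ((Polynomial.X + 1) ^ (i.1 : ℕ) *
                (Polynomial.X + 2) ^ (n - 1 - 2 * i.1) : Polynomial ℤ))
          (n - 1 - ℓ))

open Classical in
/-- A sum over all graphs, rewritten as a sum over the subsets of the complete edge set. -/
lemma sum_graphs_eq_sum_powerset {M : Type*} [AddCommMonoid M] {n : ℕ}
    (f : Finset (Sym2 (Fin n)) → M) :
    ∑ G : SimpleGraph (Fin n), f G.edgeFinset =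
      ∑ s ∈ (⊤ : SimpleGraph (Fin n)).edgeFinset.powerset, f s := by
  refine Finset.sum_bij' (fun G _ => G.edgeFinset)
    (fun s _ => SimpleGraph.fromEdgeSet (s : Set (Sym2 (Fin n)))) ?_ ?_ ?_ ?_ ?_
  · intro G _
    rw [Finset.mem_powerset]
    exact SimpleGraph.edgeFinset_mono le_top
  · intro s _
    exact Finset.mem_univ _
  · intro G _
    simp
  · intro s hs
    rw [Finset.mem_powerset] at hs
    ext e
    simp only [SimpleGraph.mem_edgeFinset, SimpleGraph.edgeSet_fromEdgeSet, Set.mem_sdiff,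
      Finset.mem_coe]
    constructor
    · exact fun h => h.1
    · intro h
      refine ⟨h, ?_⟩
      have := hs h
      simpa using this
  · intro G _
    rfl

lemma edgeSet_ncard_eq {V : Type*} [Fintype V] (G : SimpleGraph V) [Fintype G.edgeSet] :
    G.edgeSet.ncard = #G.edgeFinset := by
  rw [← SimpleGraph.coe_edgeFinset, Set.ncard_coe_finset]

open Classical in
/-- A prescribed set of `#T` edges is present with probability `p ^ #T`. -/
lemma sum_graphWeight_superset (n : ℕ) (p : ℝ) (T : Finset (Sym2 (Fin n)))
    (hT : T ⊆ (⊤ : SimpleGraph (Fin n)).edgeFinset) :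
    (∑ G : SimpleGraph (Fin n), graphWeight n p G * (if ∀ e ∈ T, e ∈ G.edgeSet then 1 else 0))
      = p ^ #T := by
  set N := (⊤ : SimpleGraph (Fin n)).edgeFinset with hN
  have hNc : #N = n.choose 2 := by
    rw [hN, SimpleGraph.card_edgeFinset_top_eq_card_choose_two, Fintype.card_fin]
  have h1 : ∀ G : SimpleGraph (Fin n),
      graphWeight n p G * (if ∀ e ∈ T, e ∈ G.edgeSet then 1 else 0) =
      (fun s : Finset (Sym2 (Fin n)) =>
        if T ⊆ s then p ^ #s * (1 - p) ^ (#N - #s) else 0) G.edgeFinset := by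
    intro G
    have : (∀ e ∈ T, e ∈ G.edgeSet) ↔ T ⊆ G.edgeFinset := by
      simp [Finset.subset_iff]
    simp only [graphWeight, edgeSet_ncard_eq, hNc, this]
    split_ifs <;> simp
  rw [Finset.sum_congr rfl (fun G _ => h1 G), sum_graphs_eq_sum_powerset
    (fun s => if T ⊆ s then p ^ #s * (1 - p) ^ (#N - #s) else 0), ← hN, ← Finset.sum_filter]
  have h2 : N.powerset.filter (fun s => T ⊆ s) = (N \ T).powerset.image (T ∪ ·) := by
    rw [← Finset.Icc_eq_image_powerset hT]
    ext s
    simp [and_comm]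
  have hdisj : ∀ r ∈ (N \ T).powerset, Disjoint T r := by
    intro r hr
    rw [Finset.mem_powerset] at hr
    exact Finset.disjoint_of_subset_right hr Finset.disjoint_sdiff
  rw [h2, Finset.sum_image]
  · have h3 : ∀ r ∈ (N \ T).powerset, p ^ #(T ∪ r) * (1 - p) ^ (#N - #(T ∪ r)) =
        p ^ #T * (p ^ #r * (1 - p) ^ (#(N \ T) - #r)) := by
      intro r hr
      rw [Finset.card_union_of_disjoint (hdisj r hr), pow_add, Finset.card_sdiff_of_subset hT,
        Nat.sub_sub, mul_assoc]
    rw [Finset.sum_congr rfl h3, ← Finset.mul_sum, Finset.sum_pow_mul_eq_add_pow]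
    simp
  · intro r hr r' hr' h
    have e1 := Finset.union_sdiff_cancel_left (hdisj r hr)
    have e2 := Finset.union_sdiff_cancel_left (hdisj r' hr')
    simp only at h
    rw [← e1, ← e2, h]

lemma erExp_one (n : ℕ) (p : ℝ) : erExp n p (fun _ => 1) = 1 := by
  simpa [erExp] using sum_graphWeight_superset n p ∅ (Finset.empty_subset _)

lemma graphWeight_nonneg {n : ℕ} {p : ℝ} (h0 : 0 ≤ p) (h1 : p ≤ 1) (G : SimpleGraph (Fin n)) :
    0 ≤ graphWeight n p G :=
  mul_nonneg (pow_nonneg h0 _) (pow_nonneg (sub_nonneg.2 h1) _)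

lemma erProb_le_one {n : ℕ} {p : ℝ} (h0 : 0 ≤ p) (h1 : p ≤ 1) (A : Set (SimpleGraph (Fin n))) :
    erProb n p A ≤ 1 := by
  rw [← erExp_one n p, erProb, erExp]
  refine Finset.sum_le_sum fun G _ => ?_
  rw [mul_one]
  exact Set.indicator_le_self' (fun _ _ => graphWeight_nonneg h0 h1 G) G

lemma erProb_mono {n : ℕ} {p : ℝ} (h0 : 0 ≤ p) (h1 : p ≤ 1) {A B : Set (SimpleGraph (Fin n))}
    (h : A ⊆ B) : erProb n p A ≤ erProb n p B :=
  Finset.sum_le_sum fun G _ =>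
    Set.indicator_le_indicator_of_subset h (fun G => graphWeight_nonneg h0 h1 G) G

/-- Markov's inequality, in complementary form. -/
lemma one_sub_erExp_le_erProb {n : ℕ} {p : ℝ} (h0 : 0 ≤ p) (h1 : p ≤ 1)
    {A : Set (SimpleGraph (Fin n))} {Z : SimpleGraph (Fin n) → ℝ} (hZ : ∀ G, 0 ≤ Z G)
    (h : ∀ G, Z G < 1 → G ∈ A) : 1 - erExp n p Z ≤ erProb n p A := by
  rw [← erExp_one n p, erProb, erExp, erExp, ← Finset.sum_sub_distrib]
  refine Finset.sum_le_sum fun G _ => ?_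
  have hw := graphWeight_nonneg h0 h1 G
  by_cases hG : G ∈ A
  · rw [Set.indicator_of_mem hG]
    nlinarith [mul_nonneg hw (hZ G)]
  · rw [Set.indicator_of_notMem hG]
    have : 1 ≤ Z G := not_lt.1 fun hlt => hG (h G hlt)
    nlinarith

lemma erExp_add (n : ℕ) (p : ℝ) (X Y : SimpleGraph (Fin n) → ℝ) :
    erExp n p (fun G => X G + Y G) = erExp n p X + erExp n p Y := by
  simp [erExp, mul_add, Finset.sum_add_distrib]

lemma erExp_const_mul (n : ℕ) (p c : ℝ) (X : SimpleGraph (Fin n) → ℝ) :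
    erExp n p (fun G => c * X G) = c * erExp n p X := by
  simp [erExp, Finset.mul_sum, mul_left_comm]

lemma erExp_sum {ι : Type*} (n : ℕ) (p : ℝ) (s : Finset ι) (X : ι → SimpleGraph (Fin n) → ℝ) :
    erExp n p (fun G => ∑ i ∈ s, X i G) = ∑ i ∈ s, erExp n p (X i) := by
  simp only [erExp, Finset.mul_sum]
  exact Finset.sum_comm

section EdgeCount

variable (n : ℕ) (p : ℝ)

open Classical in
lemma ncard_edgeSet_eq_sum (G : SimpleGraph (Fin n)) :
    (G.edgeSet.ncard : ℝ) =
      ∑ e ∈ (⊤ : SimpleGraph (Fin n)).edgeFinset, if e ∈ G.edgeSet then (1 : ℝ) else 0 := by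
  rw [edgeSet_ncard_eq, ← Finset.sum_filter, Finset.sum_const, nsmul_eq_mul, mul_one]
  congr 2
  ext e
  simp only [SimpleGraph.mem_edgeFinset, Finset.mem_filter]
  exact ⟨fun h => ⟨SimpleGraph.edgeSet_mono le_top h, h⟩, fun h => h.2⟩

lemma erExp_ncard_edgeSet : erExp n p (fun G => (G.edgeSet.ncard : ℝ)) = expEdges n p := by
  classical
  simp only [ncard_edgeSet_eq_sum]
  rw [erExp_sum]
  have : ∀ e ∈ (⊤ : SimpleGraph (Fin n)).edgeFinset,
      erExp n p (fun G => if e ∈ G.edgeSet then (1 : ℝ) else 0) = p := by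
    intro e he
    simpa [erExp] using sum_graphWeight_superset n p {e} (Finset.singleton_subset_iff.2 he)
  rw [Finset.sum_congr rfl this, Finset.sum_const,
    SimpleGraph.card_edgeFinset_top_eq_card_choose_two, Fintype.card_fin, nsmul_eq_mul, expEdges]

lemma erExp_ncard_edgeSet_sq :
    erExp n p (fun G => (G.edgeSet.ncard : ℝ) ^ 2) =
      expEdges n p + expEdges n p ^ 2 - expEdges n p * p := by
  classical
  simp only [ncard_edgeSet_eq_sum, sq, Finset.sum_mul_sum]
  simp_rw [erExp_sum]
  set N := (⊤ : SimpleGraph (Fin n)).edgeFinset with hN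
  have hNc : #N = n.choose 2 := by
    rw [hN, SimpleGraph.card_edgeFinset_top_eq_card_choose_two, Fintype.card_fin]
  have : ∀ e ∈ N, ∀ e' ∈ N,
      erExp n p (fun G => (if e ∈ G.edgeSet then (1 : ℝ) else 0) *
        (if e' ∈ G.edgeSet then (1 : ℝ) else 0)) = p ^ 2 + if e = e' then p - p ^ 2 else 0 := by
    intro e he e' he'
    have key := sum_graphWeight_superset n p {e, e'} (by
      intro x hx
      simp only [Finset.mem_insert, Finset.mem_singleton] at hx
      rcases hx with rfl | rfl <;> assumption)
    have h2 : erExp n p (fun G => (if e ∈ G.edgeSet then (1 : ℝ) else 0) *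
        (if e' ∈ G.edgeSet then (1 : ℝ) else 0)) = p ^ #({e, e'} : Finset (Sym2 (Fin n))) := by
      rw [← key, erExp]
      refine Finset.sum_congr rfl fun G _ => ?_
      congr 1
      simp only [Finset.mem_insert, Finset.mem_singleton, forall_eq_or_imp, forall_eq]
      split_ifs <;> simp_all
    rw [h2]
    split_ifs with h
    · subst h
      simp
    · rw [Finset.card_pair h]
      ring
  rw [Finset.sum_congr rfl fun e he => Finset.sum_congr rfl (this e he)]
  simp only [Finset.sum_add_distrib, Finset.sum_const, Finset.sum_ite_eq, nsmul_eq_mul,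
    Finset.sum_ite_mem, Finset.inter_self, hNc, expEdges]
  ring

lemma erExp_edge_deviation_sq_le (h0 : 0 ≤ p) :
    erExp n p (fun G => ((G.edgeSet.ncard : ℝ) - expEdges n p) ^ 2) ≤ expEdges n p := by
  have h : (fun G : SimpleGraph (Fin n) => ((G.edgeSet.ncard : ℝ) - expEdges n p) ^ 2) =
      fun G => ((G.edgeSet.ncard : ℝ) ^ 2 + (-2 * expEdges n p) * (G.edgeSet.ncard : ℝ)) +
        expEdges n p ^ 2 * 1 := by
    funext G
    ring
  rw [h, erExp_add, erExp_add, erExp_const_mul, erExp_const_mul, erExp_one,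
    erExp_ncard_edgeSet, erExp_ncard_edgeSet_sq]
  have : 0 ≤ expEdges n p * p := mul_nonneg (mul_nonneg (Nat.cast_nonneg _) h0) h0
  nlinarith

end EdgeCount

section CycleCount

variable {V : Type*} [Fintype V]

open Classical in
/-- The closed walks of length `m` based at `u` in the complete graph that are cycles. -/
noncomputable def completeCycles (V : Type*) [Fintype V] (m : ℕ) (u : V) :
    Finset ((⊤ : SimpleGraph V).Walk u u) :=
  {W ∈ (⊤ : SimpleGraph V).finsetWalkLength m u u | W.IsCycle}

open Classical in
lemma mem_completeCycles {m : ℕ} {u : V} {W : (⊤ : SimpleGraph V).Walk u u} :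
    W ∈ completeCycles V m u ↔ W.length = m ∧ W.IsCycle := by
  rw [completeCycles, Finset.mem_filter, SimpleGraph.mem_finsetWalkLength_iff]

open Classical in
/-- The based directed cycles of length `m` of `G`. -/
noncomputable def basedCycles (G : SimpleGraph V) (m : ℕ) (u : V) :
    Finset ((⊤ : SimpleGraph V).Walk u u) :=
  {W ∈ completeCycles V m u | ∀ e ∈ W.edges, e ∈ G.edgeSet}

/-- The number of based directed cycles of length `m` of `G`. -/
noncomputable def basedCycleCount (G : SimpleGraph V) (m : ℕ) : ℕ :=
  ∑ u, #(basedCycles G m u)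

lemma card_finsetWalkLength_succ_le [DecidableEq V] (G : SimpleGraph V) [G.LocallyFinite]
    (m : ℕ) (u v : V) :
    #(G.finsetWalkLength (m + 1) u v) ≤ Fintype.card V ^ m := by
  induction m generalizing u with
  | zero =>
    rw [pow_zero, Finset.card_le_one]
    intro a ha b hb
    rw [SimpleGraph.mem_finsetWalkLength_iff] at ha hb
    cases a with
    | nil => simp at ha
    | cons h a' =>
      cases b with
      | nil => simp at hb
      | cons h' b' =>
        cases a' with
        | cons _ _ => simp at ha
        | nil =>
          cases b' with
          | cons _ _ => simp at hb
          | nil => rfl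
  | succ m ih =>
    rw [SimpleGraph.finsetWalkLength]
    refine Finset.card_biUnion_le.trans ?_
    calc _ ≤ ∑ _w : G.neighborSet u, Fintype.card V ^ m := by
          refine Finset.sum_le_sum fun w _ => ?_
          rw [Finset.card_map]
          exact ih w
      _ = G.degree u * Fintype.card V ^ m := by
          rw [Finset.sum_const, Finset.card_univ, SimpleGraph.card_neighborSet_eq_degree,
            smul_eq_mul]
      _ ≤ _ := by
          rw [pow_succ']
          exact Nat.mul_le_mul_right _ (Finset.card_le_univ _)

lemma card_completeCycles_le (m : ℕ) (u : V) :
    #(completeCycles V (m + 1) u) ≤ Fintype.card V ^ m := by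
  classical
  refine le_trans ?_ (card_finsetWalkLength_succ_le (⊤ : SimpleGraph V) m u u)
  rw [completeCycles]
  exact (Finset.card_filter_le _ _).trans (le_of_eq (by congr!))

end CycleCount

lemma erExp_basedCycleCount_le {n : ℕ} {p : ℝ} (h0 : 0 ≤ p) (m : ℕ) (hm : 1 ≤ m) :
    erExp n p (fun G => (basedCycleCount G m : ℝ)) ≤ (n * p) ^ m := by
  classical
  have h : ∀ G : SimpleGraph (Fin n), (basedCycleCount G m : ℝ) =
      ∑ u, ∑ W ∈ completeCycles (Fin n) m u,
        if ∀ e ∈ W.edges, e ∈ G.edgeSet then (1 : ℝ) else 0 := by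
    intro G
    rw [basedCycleCount, Nat.cast_sum]
    refine Finset.sum_congr rfl fun u _ => ?_
    rw [basedCycles, Finset.card_filter, Nat.cast_sum]
    simp
  simp only [h, erExp_sum]
  have h2 : ∀ u, ∀ W ∈ completeCycles (Fin n) m u,
      erExp n p (fun G => if ∀ e ∈ W.edges, e ∈ G.edgeSet then (1 : ℝ) else 0) = p ^ m := by
    intro u W hW
    rw [mem_completeCycles] at hW
    have := sum_graphWeight_superset n p W.edges.toFinset (by
      intro e he
      rw [List.mem_toFinset] at he
      exact SimpleGraph.mem_edgeFinset.2 (W.edges_subset_edgeSet he))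
    rw [List.toFinset_card_of_nodup hW.2.edges_nodup, SimpleGraph.Walk.length_edges, hW.1] at this
    rw [← this, erExp]
    simp only [List.mem_toFinset]
  obtain ⟨m, rfl⟩ : ∃ m', m = m' + 1 := ⟨m - 1, by omega⟩
  calc _ = ∑ u : Fin n, (#(completeCycles (Fin n) (m + 1) u) : ℝ) * p ^ (m + 1) := by
        refine Finset.sum_congr rfl fun u _ => ?_
        rw [Finset.sum_congr rfl (h2 u), Finset.sum_const, nsmul_eq_mul]
    _ ≤ ∑ u : Fin n, ((n : ℝ) ^ m) * p ^ (m + 1) := by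
        refine Finset.sum_le_sum fun u _ => mul_le_mul_of_nonneg_right ?_ (pow_nonneg h0 _)
        have := card_completeCycles_le m u
        rw [Fintype.card_fin] at this
        exact_mod_cast this
    _ = (n * p) ^ (m + 1) := by
        rw [Finset.sum_const, Finset.card_univ, Fintype.card_fin, nsmul_eq_mul]
        ring

section FaceCount

/-- At most `2 ^ #W * D ^ (ℓ - j)` of the `ℓ`-subsets of a `D`-element type meet `W` in at
least `j` elements. -/
lemma card_filter_inter_le {α : Type*} [Fintype α] [DecidableEq α] (W : Finset α) (ℓ j : ℕ) :
    #{S ∈ (Finset.univ : Finset α).powersetCard ℓ | j ≤ #(S ∩ W)} ≤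
      2 ^ #W * Fintype.card α ^ (ℓ - j) := by
  have hsub : {S ∈ (Finset.univ : Finset α).powersetCard ℓ | j ≤ #(S ∩ W)} ⊆
      (W.powerset ×ˢ (Finset.univ : Finset α).powersetCard (ℓ - j)).image
        (fun x => x.1 ∪ x.2) := by
    intro S hS
    rw [Finset.mem_filter, Finset.mem_powersetCard] at hS
    obtain ⟨⟨-, hc⟩, hj⟩ := hS
    obtain ⟨U, hU, hUc⟩ := Finset.exists_subset_card_eq hj
    have hUS : U ⊆ S := hU.trans Finset.inter_subset_left
    rw [Finset.mem_image]
    refine ⟨(U, S \ U), ?_, Finset.union_sdiff_of_subset hUS⟩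
    rw [Finset.mem_product, Finset.mem_powerset, Finset.mem_powersetCard]
    refine ⟨hU.trans Finset.inter_subset_right, Finset.subset_univ _, ?_⟩
    rw [Finset.card_sdiff_of_subset hUS, hc, hUc]
  refine (Finset.card_le_card hsub).trans (Finset.card_image_le.trans ?_)
  rw [Finset.card_product, Finset.card_powerset, Finset.card_powersetCard, Finset.card_univ]
  exact Nat.mul_le_mul_left _ (Nat.choose_le_pow _ _)

variable {V : Type*} [Fintype V] (G : SimpleGraph V) (elt : Sym2 V → Sym2 V → Prop)

open Classical in
lemma numFaces_eq_card_filter (ℓ : ℕ) :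
    numFaces G elt ℓ =
      #(((Finset.univ : Finset G.Dart).powersetCard ℓ).filter
        fun S : Finset G.Dart => IsFace G elt (S : Set G.Dart)) := by
  rw [numFaces, ← Set.ncard_coe_finset,
    ← Set.ncard_image_of_injective _ (Finset.coe_injective (α := G.Dart))]
  congr 1
  ext S
  simp only [Set.mem_ofPred_eq, Set.mem_image, Finset.coe_filter, Finset.mem_powersetCard]
  constructor
  · rintro ⟨h1, h2⟩
    refine ⟨S.toFinite.toFinset, ⟨⟨Finset.subset_univ _, ?_⟩, ?_⟩, ?_⟩
    · rw [← Set.ncard_eq_toFinset_card S, h1]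
    · simpa using h2
    · simp
  · rintro ⟨T, ⟨⟨-, h1⟩, h2⟩, rfl⟩
    exact ⟨by rw [Set.ncard_coe_finset, h1], h2⟩

open Classical in
lemma numFaces_le_choose (ℓ : ℕ) : numFaces G elt ℓ ≤ (Fintype.card G.Dart).choose ℓ := by
  rw [numFaces_eq_card_filter, ← Finset.card_univ, ← Finset.card_powersetCard]
  exact Finset.card_filter_le _ (fun S : Finset G.Dart => IsFace G elt (S : Set G.Dart))

open Classical in
/-- The darts of `G` that are arcs of the closed walk `W` of the complete graph. -/
noncomputable def dartsOn {u : V} (W : (⊤ : SimpleGraph V).Walk u u) : Finset G.Dart :=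
  {d | d.toProd ∈ W.darts.map SimpleGraph.Dart.toProd}

open Classical in
lemma card_dartsOn_le {u : V} (W : (⊤ : SimpleGraph V).Walk u u) :
    #(dartsOn G W) ≤ W.length := by
  have h : (dartsOn G W).image SimpleGraph.Dart.toProd ⊆
      (W.darts.map SimpleGraph.Dart.toProd).toFinset := by
    intro x hx
    rw [Finset.mem_image] at hx
    obtain ⟨d, hd, rfl⟩ := hx
    rw [List.mem_toFinset]
    exact (Finset.mem_filter.1 hd).2
  rw [← Finset.card_image_of_injective _ SimpleGraph.Dart.toProd_injective]
  refine (Finset.card_le_card h).trans ((List.toFinset_card_le _).trans ?_)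
  rw [List.length_map, SimpleGraph.Walk.length_darts]

open Classical in
/-- Every set of darts that is not a face contains two antipodal darts or at least `j` arcs of a
cycle of length `2 * j - 1` or `2 * j`. -/
lemma exists_of_not_isFace {S : Finset G.Dart} (h : ¬ IsFace G elt (S : Set G.Dart)) :
    (∃ d : G.Dart, 2 ≤ #(S ∩ {d, d.symm})) ∨
      ∃ j, 2 ≤ j ∧ j ≤ #S ∧ ∃ m, (m = 2 * j - 1 ∨ m = 2 * j) ∧
        ∃ u, ∃ W ∈ basedCycles G m u, j ≤ #(S ∩ dartsOn G W) := by
  by_cases h1 : ∃ d ∈ S, d.symm ∈ S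
  · left
    obtain ⟨d, hd, hd'⟩ := h1
    refine ⟨d, ?_⟩
    rw [Finset.inter_eq_right.2 (by
      intro x hx
      simp only [Finset.mem_insert, Finset.mem_singleton] at hx
      rcases hx with rfl | rfl <;> assumption), Finset.card_pair d.symm_ne.symm]
  · right
    have key : ∀ j, 2 ≤ j → ∀ (u : V) (w : G.Walk u u), w.IsCycle →
        (w.length = 2 * j - 1 ∨ w.length = 2 * j) →
        j ≤ Set.ncard {d ∈ (S : Set G.Dart) | d ∈ w.darts} →
        ∃ j, 2 ≤ j ∧ j ≤ #S ∧ ∃ m, (m = 2 * j - 1 ∨ m = 2 * j) ∧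
        ∃ u, ∃ W ∈ basedCycles G m u, j ≤ #(S ∩ dartsOn G W) := by
      intro j hj u w hw hl hc
      have e : {d ∈ (S : Set G.Dart) | d ∈ w.darts} ⊆
          ((S ∩ dartsOn G (w.mapLe le_top) : Finset G.Dart) : Set G.Dart) := by
        rintro d ⟨hd, hdw⟩
        rw [Finset.coe_inter]
        refine ⟨hd, ?_⟩
        rw [Finset.mem_coe, dartsOn, Finset.mem_filter]
        refine ⟨Finset.mem_univ _, ?_⟩
        rw [SimpleGraph.Walk.darts_map, List.map_map]
        exact List.mem_map.2 ⟨d, hdw, rfl⟩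
      have hle : j ≤ #(S ∩ dartsOn G (w.mapLe le_top)) := by
        rw [← Set.ncard_coe_finset]
        exact hc.trans (Set.ncard_le_ncard e (Finset.finite_toSet _))
      refine ⟨j, hj, hle.trans (Finset.card_le_card Finset.inter_subset_left), w.length, hl, u,
        w.mapLe le_top, ?_, hle⟩
      rw [basedCycles, Finset.mem_filter, mem_completeCycles]
      refine ⟨⟨SimpleGraph.Walk.length_map _ _, (SimpleGraph.Walk.isCycle_mapLe _).2 hw⟩, ?_⟩
      intro a ha
      rw [SimpleGraph.Walk.edges_mapLe_eq_edges] at ha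
      exact w.edges_subset_edgeSet ha
    rw [IsFace, not_and] at h
    have h2 := h (by simpa using h1)
    push Not at h2
    obtain ⟨j, hj, u, w, hw, h3⟩ := h2
    by_cases hodd : w.length = 2 * j - 1 ∧ j ≤ Set.ncard {d ∈ (S : Set G.Dart) | d ∈ w.darts}
    · exact key j hj u w hw (Or.inl hodd.1) hodd.2
    · have h4 := h3 (fun hl => not_le.1 fun hle => hodd ⟨hl, hle⟩)
      refine key j hj u w hw (Or.inr h4.1) (h4.2.trans (Set.ncard_le_ncard ?_
        (Set.toFinite _)))
      rintro d ⟨hd, hdw, -⟩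
      exact ⟨hd, hdw⟩

open Classical in
/-- A lower bound on the number of faces in terms of the numbers of short cycles. -/
lemma choose_le_numFaces_add (ℓ : ℕ) :
    (Fintype.card G.Dart).choose ℓ ≤ numFaces G elt ℓ + 4 * Fintype.card G.Dart ^ (ℓ - 1) +
      ∑ j ∈ Finset.Icc 2 ℓ, (basedCycleCount G (2 * j - 1) + basedCycleCount G (2 * j)) *
        (4 ^ j * Fintype.card G.Dart ^ (ℓ - j)) := by
  set D := Fintype.card G.Dart with hD
  set P := (Finset.univ : Finset G.Dart).powersetCard ℓ with hP
  let A : Finset (Finset G.Dart) :=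
    if 2 ≤ ℓ then Finset.univ.biUnion fun d : G.Dart => {S ∈ P | 2 ≤ #(S ∩ {d, d.symm})} else ∅
  let C (j m : ℕ) : Finset (Finset G.Dart) := Finset.univ.biUnion fun u : V =>
    (basedCycles G m u).biUnion fun W => {S ∈ P | j ≤ #(S ∩ dartsOn G W)}
  have hA : #A ≤ 4 * D ^ (ℓ - 1) := by
    by_cases h : 2 ≤ ℓ
    · simp only [A, if_pos h]
      refine Finset.card_biUnion_le.trans ?_
      calc _ ≤ ∑ _d : G.Dart, 4 * D ^ (ℓ - 2) := by
            refine Finset.sum_le_sum fun d _ => (card_filter_inter_le _ _ _).trans ?_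
            rw [Finset.card_pair d.symm_ne.symm, ← hD]
            norm_num
        _ = 4 * D ^ (ℓ - 1) := by
            rw [Finset.sum_const, Finset.card_univ, smul_eq_mul, ← hD,
              show ℓ - 1 = (ℓ - 2) + 1 by omega]
            ring
    · simp [A, h]
  have hC : ∀ j m, m ≤ 2 * j → #(C j m) ≤ basedCycleCount G m * (4 ^ j * D ^ (ℓ - j)) := by
    intro j m hm
    refine Finset.card_biUnion_le.trans ?_
    rw [basedCycleCount, Finset.sum_mul]
    refine Finset.sum_le_sum fun u _ => Finset.card_biUnion_le.trans ?_
    rw [← smul_eq_mul, ← Finset.sum_const]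
    refine Finset.sum_le_sum fun W hW => (card_filter_inter_le _ _ _).trans ?_
    refine Nat.mul_le_mul_right _ ?_
    have hl : W.length = m := (mem_completeCycles.1 (Finset.mem_filter.1 hW).1).1
    calc 2 ^ #(dartsOn G W) ≤ 2 ^ (2 * j) :=
          Nat.pow_le_pow_right two_pos ((card_dartsOn_le G W).trans (hl ▸ hm))
      _ = 4 ^ j := by
          rw [pow_mul]
          norm_num
  have hcover : P ⊆ (P.filter (fun S : Finset G.Dart => IsFace G elt (S : Set G.Dart)) ∪ A) ∪
      (Finset.Icc 2 ℓ).biUnion fun j => C j (2 * j - 1) ∪ C j (2 * j) := by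
    intro S hS
    have hcard : #S = ℓ := (Finset.mem_powersetCard.1 hS).2
    by_cases hF : IsFace G elt (S : Set G.Dart)
    · exact Finset.mem_union_left _ (Finset.mem_union_left _ (Finset.mem_filter.2 ⟨hS, hF⟩))
    · rcases exists_of_not_isFace G elt hF with ⟨d, hd⟩ | ⟨j, hj, hjS, m, hm, u, W, hW, hWS⟩
      · refine Finset.mem_union_left _ (Finset.mem_union_right _ ?_)
        have h2 : 2 ≤ ℓ := hcard ▸ hd.trans (Finset.card_le_card Finset.inter_subset_left)
        simp only [A, if_pos h2]
        exact Finset.mem_biUnion.2 ⟨d, Finset.mem_univ _, Finset.mem_filter.2 ⟨hS, hd⟩⟩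
      · refine Finset.mem_union_right _ (Finset.mem_biUnion.2
          ⟨j, Finset.mem_Icc.2 ⟨hj, hcard ▸ hjS⟩, ?_⟩)
        have hmem : S ∈ C j m := Finset.mem_biUnion.2 ⟨u, Finset.mem_univ _,
          Finset.mem_biUnion.2 ⟨W, hW, Finset.mem_filter.2 ⟨hS, hWS⟩⟩⟩
        rcases hm with rfl | rfl
        · exact Finset.mem_union_left _ hmem
        · exact Finset.mem_union_right _ hmem
  have hPc : #P = D.choose ℓ := by rw [hP, Finset.card_powersetCard, Finset.card_univ]
  rw [← hPc, numFaces_eq_card_filter]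
  refine (Finset.card_le_card hcover).trans ((Finset.card_union_le _ _).trans
    (Nat.add_le_add ((Finset.card_union_le _ _).trans (Nat.add_le_add_left hA _)) ?_))
  refine Finset.card_biUnion_le.trans (Finset.sum_le_sum fun j _ => ?_)
  rw [add_mul]
  exact (Finset.card_union_le _ _).trans
    (Nat.add_le_add (hC j _ (Nat.sub_le _ _)) (hC j _ le_rfl))

open Classical in
lemma card_dart_eq_two_mul_ncard : Fintype.card G.Dart = 2 * G.edgeSet.ncard := by
  rw [SimpleGraph.dart_card_eq_twice_card_edges, edgeSet_ncard_eq]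

end FaceCount

section Asymptotics

lemma numFaces_le_of_edges {n : ℕ} (G : SimpleGraph (Fin n))
    (elt : Sym2 (Fin n) → Sym2 (Fin n) → Prop) {E δ : ℝ}
    (hX : (G.edgeSet.ncard : ℝ) ≤ (1 + δ) * E) (ℓ : ℕ) :
    (numFaces G elt ℓ : ℝ) ≤ (1 + δ) ^ ℓ * ((2 * E) ^ ℓ / (ℓ.factorial : ℝ)) := by
  classical
  have h1 : (numFaces G elt ℓ : ℝ) ≤ ((Fintype.card G.Dart).choose ℓ : ℝ) := by
    exact_mod_cast numFaces_le_choose G elt ℓ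
  have h2 : ((Fintype.card G.Dart).choose ℓ : ℝ) ≤
      ((Fintype.card G.Dart : ℕ) : ℝ) ^ ℓ / (ℓ.factorial : ℝ) := Nat.choose_le_pow_div ℓ _
  refine h1.trans (h2.trans ?_)
  rw [card_dart_eq_two_mul_ncard, ← mul_div_assoc, ← mul_pow]
  push_cast
  have h3 : 2 * (G.edgeSet.ncard : ℝ) ≤ (1 + δ) * (2 * E) := by linarith
  gcongr

lemma le_numFaces_of_edges {n k ℓ : ℕ} (hℓ : 1 ≤ ℓ) (hℓk : ℓ ≤ k) (G : SimpleGraph (Fin n))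
    (elt : Sym2 (Fin n) → Sym2 (Fin n) → Prop) {E p s δ : ℝ} (hE : 0 < E) (hs : 0 < s)
    (hp0 : 0 ≤ p) (hp1 : p ≤ 1) (hps : p * s = 1 / s) (hq : 1 ≤ n * p)
    (hqE : (n * p) ^ 2 ≤ 4 * E * p) (hδ : δ ≤ 1)
    (hXl : (1 - δ) * E ≤ (G.edgeSet.ncard : ℝ)) (hXu : (G.edgeSet.ncard : ℝ) ≤ (1 + δ) * E)
    (hcyc : ∀ m, 3 ≤ m → m ≤ 2 * k → (basedCycleCount G m : ℝ) ≤ (n * p) ^ m * s)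
    (hlE : (ℓ : ℝ) ≤ 2 * E * (1 - δ)) :
    ((1 - δ - ℓ / (2 * E)) ^ ℓ - ℓ.factorial * 2 ^ ℓ * (1 / E + 2 * ℓ * 4 ^ ℓ / s)) *
      ((2 * E) ^ ℓ / (ℓ.factorial : ℝ)) ≤ (numFaces G elt ℓ : ℝ) := by
  classical
  set D : ℕ := Fintype.card G.Dart with hD
  have hDX : (D : ℝ) = 2 * (G.edgeSet.ncard : ℝ) := by
    rw [hD, card_dart_eq_two_mul_ncard]
    push_cast
    ring
  have hDu : (D : ℝ) ≤ 4 * E := by nlinarith [mul_le_mul_of_nonneg_right hδ hE.le]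
  have hDl : 2 * E * (1 - δ) ≤ D := by linarith
  have hD0 : (0 : ℝ) ≤ D := Nat.cast_nonneg _
  have hfac : (0 : ℝ) < ℓ.factorial := Nat.cast_pos.2 ℓ.factorial_pos
  have hlD : ℓ ≤ D := by exact_mod_cast hlE.trans hDl
  have hchoose : (1 - δ - ℓ / (2 * E)) ^ ℓ * ((2 * E) ^ ℓ / (ℓ.factorial : ℝ)) ≤
      (D.choose ℓ : ℝ) := by
    have h1 : (((D + 1 - ℓ : ℕ) : ℝ) ^ ℓ) / (ℓ.factorial : ℝ) ≤ (D.choose ℓ : ℝ) :=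
      Nat.pow_le_choose ℓ D
    refine le_trans ?_ h1
    rw [← mul_div_assoc, ← mul_pow]
    have h2 : (1 - δ - ℓ / (2 * E)) * (2 * E) = 2 * E * (1 - δ) - ℓ := by
      field_simp
    rw [h2, Nat.cast_sub (by omega)]
    push_cast
    gcongr
    linarith
  have hsum : ∀ j ∈ Finset.Icc 2 ℓ,
      ((basedCycleCount G (2 * j - 1) : ℝ) + basedCycleCount G (2 * j)) *
        (4 ^ j * (D : ℝ) ^ (ℓ - j)) ≤ 2 * 4 ^ ℓ / s * (4 * E) ^ ℓ := by
    intro j hj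
    obtain ⟨hj2, hjl⟩ := Finset.mem_Icc.1 hj
    have hc : ∀ m, 3 ≤ m → m ≤ 2 * j → (basedCycleCount G m : ℝ) ≤ (4 * E) ^ j * (1 / s) := by
      intro m hm3 hmj
      calc (basedCycleCount G m : ℝ) ≤ (n * p) ^ m * s := hcyc m hm3 (by omega)
        _ ≤ (n * p) ^ (2 * j) * s := by gcongr
        _ ≤ (4 * E * p) ^ j * s := by
            rw [pow_mul]
            gcongr
        _ = (4 * E) ^ j * p ^ j * s := by rw [mul_pow]
        _ ≤ (4 * E) ^ j * p * s := by
            gcongr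
            exact pow_le_of_le_one hp0 hp1 (by omega)
        _ = (4 * E) ^ j * (1 / s) := by rw [mul_assoc, hps]
    calc _ ≤ ((4 * E) ^ j * (1 / s) + (4 * E) ^ j * (1 / s)) * (4 ^ ℓ * (4 * E) ^ (ℓ - j)) := by
          gcongr
          · exact hc _ (by omega) (by omega)
          · exact hc _ (by omega) le_rfl
          · norm_num
      _ = 2 * 4 ^ ℓ / s * ((4 * E) ^ j * (4 * E) ^ (ℓ - j)) := by ring
      _ = 2 * 4 ^ ℓ / s * (4 * E) ^ ℓ := by rw [← pow_add, Nat.add_sub_cancel' hjl]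
  have hmain : (D.choose ℓ : ℝ) ≤ numFaces G elt ℓ + 4 * (D : ℝ) ^ (ℓ - 1) +
      ∑ j ∈ Finset.Icc 2 ℓ, ((basedCycleCount G (2 * j - 1) : ℝ) + basedCycleCount G (2 * j)) *
        (4 ^ j * (D : ℝ) ^ (ℓ - j)) := by
    exact_mod_cast choose_le_numFaces_add G elt ℓ
  have hanti : 4 * (D : ℝ) ^ (ℓ - 1) ≤ 1 / E * (4 * E) ^ ℓ := by
    calc 4 * (D : ℝ) ^ (ℓ - 1) ≤ 4 * (4 * E) ^ (ℓ - 1) := by gcongr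
      _ = 1 / E * ((4 * E) ^ (ℓ - 1) * (4 * E)) := by field_simp
      _ = 1 / E * (4 * E) ^ ℓ := by rw [pow_sub_one_mul (by omega)]
  have hcycles : ∑ j ∈ Finset.Icc 2 ℓ,
      ((basedCycleCount G (2 * j - 1) : ℝ) + basedCycleCount G (2 * j)) *
        (4 ^ j * (D : ℝ) ^ (ℓ - j)) ≤ ℓ * (2 * 4 ^ ℓ / s * (4 * E) ^ ℓ) := by
    refine (Finset.sum_le_card_nsmul _ _ _ hsum).trans ?_
    rw [nsmul_eq_mul]
    gcongr
    rw [Nat.card_Icc]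
    omega
  have hsplit : ((1 - δ - ℓ / (2 * E)) ^ ℓ -
      ℓ.factorial * 2 ^ ℓ * (1 / E + 2 * ℓ * 4 ^ ℓ / s)) * ((2 * E) ^ ℓ / (ℓ.factorial : ℝ)) =
      (1 - δ - ℓ / (2 * E)) ^ ℓ * ((2 * E) ^ ℓ / (ℓ.factorial : ℝ)) -
        (1 / E + 2 * ℓ * 4 ^ ℓ / s) * (4 * E) ^ ℓ := by
    rw [show (4 * E) ^ ℓ = 2 ^ ℓ * (2 * E) ^ ℓ by rw [← mul_pow]; ring_nf]
    field_simp
  rw [hsplit]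
  have : (1 / E + 2 * ℓ * 4 ^ ℓ / s) * (4 * E) ^ ℓ =
      1 / E * (4 * E) ^ ℓ + ℓ * (2 * 4 ^ ℓ / s * (4 * E) ^ ℓ) := by ring
  linarith

lemma edgeProb_mem {β : ℝ} (hβ0 : 0 < β) (n : ℕ) (hn : 1 ≤ n) :
    0 < (n : ℝ) ^ (-β) ∧ (n : ℝ) ^ (-β) ≤ 1 :=
  ⟨Real.rpow_pos_of_pos (by exact_mod_cast hn) _,
    Real.rpow_le_one_of_one_le_of_nonpos (by exact_mod_cast hn) (by linarith)⟩

lemma expEdges_eq (n : ℕ) (p : ℝ) : expEdges n p = n * (n - 1) / 2 * p := by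
  rw [expEdges, Nat.cast_choose_two]

lemma expEdges_eq_rpow_mul {β : ℝ} {n : ℕ} (hn : 1 ≤ n) :
    expEdges n ((n : ℝ) ^ (-β)) = (n : ℝ) ^ (2 - β) * ((1 - 1 / n) / 2) := by
  have hn0 : (0 : ℝ) < n := by exact_mod_cast hn
  rw [expEdges_eq, sub_eq_add_neg 2, Real.rpow_add hn0, Real.rpow_two]
  field_simp

lemma expEdges_bounds {β : ℝ} {n : ℕ} (hn : 2 ≤ n) :
    (n : ℝ) ^ (2 - β) / 4 ≤ expEdges n ((n : ℝ) ^ (-β)) ∧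
      expEdges n ((n : ℝ) ^ (-β)) ≤ (n : ℝ) ^ (2 - β) / 2 := by
  have hn2 : (2 : ℝ) ≤ n := by exact_mod_cast hn
  have hpos : 0 < (n : ℝ) ^ (2 - β) := Real.rpow_pos_of_pos (by linarith) _
  have h1 : 0 ≤ 1 / (n : ℝ) := by positivity
  have h2 : 1 / (n : ℝ) ≤ 1 / 2 := one_div_le_one_div_of_le two_pos hn2
  rw [expEdges_eq_rpow_mul (by omega)]
  constructor <;> nlinarith

lemma tendsto_expEdges {β : ℝ} (hβ1 : β < 1) :
    Tendsto (fun n : ℕ => expEdges n ((n : ℝ) ^ (-β))) atTop atTop := by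
  have h : Tendsto (fun n : ℕ => (n : ℝ) ^ (2 - β) / 4) atTop atTop :=
    ((tendsto_rpow_atTop (by linarith)).comp tendsto_natCast_atTop_atTop).atTop_div_const
      (by norm_num)
  refine tendsto_atTop_mono' _ ?_ h
  filter_upwards [eventually_ge_atTop 2] with n hn
  exact (expEdges_bounds hn).1

/-- The face numbers of a random graph are asymptotic to those of the complex of all sets of
darts. -/
lemma tendsto_erProb_numFaces_near {β : ℝ} (hβ0 : 0 < β) (hβ1 : β < 1) (k : ℕ)
    (elt : ∀ n : ℕ, Sym2 (Fin n) → Sym2 (Fin n) → Prop) {η : ℝ} (hη : 0 < η) :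
    Tendsto (fun n => erProb n ((n : ℝ) ^ (-β))
      {G | ∀ ℓ, 1 ≤ ℓ → ℓ ≤ k →
        (1 - η) * ((2 * expEdges n ((n : ℝ) ^ (-β))) ^ ℓ / (ℓ.factorial : ℝ)) ≤
            (numFaces G (elt n) ℓ : ℝ) ∧
          (numFaces G (elt n) ℓ : ℝ) ≤
            (1 + η) * ((2 * expEdges n ((n : ℝ) ^ (-β))) ^ ℓ / (ℓ.factorial : ℝ))})
      atTop (nhds 1) := by
  set p : ℕ → ℝ := fun n => (n : ℝ) ^ (-β) with hp
  set E : ℕ → ℝ := fun n => expEdges n (p n) with hEdef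
  set s : ℕ → ℝ := fun n => (n : ℝ) ^ (β / 2) with hs
  set δ : ℕ → ℝ := fun n => E n ^ (-(1 / 4) : ℝ) with hδ
  have hElim : Tendsto E atTop atTop := tendsto_expEdges hβ1
  have hslim : Tendsto s atTop atTop :=
    (tendsto_rpow_atTop (by linarith)).comp tendsto_natCast_atTop_atTop
  have hδlim : Tendsto δ atTop (nhds 0) :=
    (tendsto_rpow_neg_atTop (by norm_num : (0 : ℝ) < 1 / 4)).comp hElim
  have hqlim : Tendsto (fun n : ℕ => n * p n) atTop atTop := by
    have h : Tendsto (fun n : ℕ => (n : ℝ) ^ (1 - β)) atTop atTop :=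
      (tendsto_rpow_atTop (by linarith)).comp tendsto_natCast_atTop_atTop
    refine h.congr' ?_
    filter_upwards [eventually_ge_atTop 1] with n hn
    rw [sub_eq_add_neg, Real.rpow_add (by exact_mod_cast hn), Real.rpow_one]
  have hupper : ∀ ℓ, ∀ᶠ n in atTop, (1 + δ n) ^ ℓ ≤ 1 + η := by
    intro ℓ
    have h : Tendsto (fun n => (1 + δ n) ^ ℓ) atTop (nhds ((1 + 0) ^ ℓ)) :=
      (hδlim.const_add 1).pow ℓ
    rw [add_zero, one_pow] at h
    exact h.eventually_le_const (by linarith)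
  have hlower : ∀ ℓ : ℕ, ∀ᶠ n in atTop, 1 - η ≤ (1 - δ n - ℓ / (2 * E n)) ^ ℓ -
      ℓ.factorial * 2 ^ ℓ * (1 / E n + 2 * ℓ * 4 ^ ℓ / s n) := by
    intro ℓ
    have h1 : Tendsto (fun n => (ℓ : ℝ) / (2 * E n)) atTop (nhds 0) :=
      (hElim.const_mul_atTop two_pos).const_div_atTop _
    have h2 : Tendsto (fun n => 1 / E n + 2 * ℓ * 4 ^ ℓ / s n) atTop (nhds (0 + 0)) :=
      (hElim.const_div_atTop _).add (hslim.const_div_atTop _)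
    have h : Tendsto (fun n => (1 - δ n - ℓ / (2 * E n)) ^ ℓ -
        ℓ.factorial * 2 ^ ℓ * (1 / E n + 2 * ℓ * 4 ^ ℓ / s n)) atTop
        (nhds ((1 - 0 - 0) ^ ℓ - ℓ.factorial * 2 ^ ℓ * (0 + 0))) :=
      (((hδlim.const_sub 1).sub h1).pow ℓ).sub (h2.const_mul _)
    simp only [sub_zero, one_pow, add_zero, mul_zero] at h
    exact h.eventually_const_le (by linarith)
  have hsize : ∀ᶠ n in atTop, (k : ℝ) ≤ E n ∧ δ n ≤ 1 / 2 :=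
    (hElim.eventually_ge_atTop _).and (hδlim.eventually_le_const (by norm_num))
  have herr : Tendsto (fun n => 1 - (δ n ^ 2 + 2 * k / s n)) atTop (nhds 1) := by
    have h := ((hδlim.pow 2).add (hslim.const_div_atTop (2 * (k : ℝ)))).const_sub 1
    simpa using h
  refine tendsto_of_tendsto_of_tendsto_of_le_of_le' herr tendsto_const_nhds ?_ ?_
  · have hall := (Filter.eventually_all_finset (Finset.Icc 1 k)).2
      fun ℓ _ => (hupper ℓ).and (hlower ℓ)
    filter_upwards [hall, hsize, eventually_ge_atTop 2, hElim.eventually_gt_atTop 0,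
      hqlim.eventually_ge_atTop 1] with n hall ⟨hkE, hδ2⟩ hn hE0 hq
    have hn2 : (2 : ℝ) ≤ n := by exact_mod_cast hn
    have hn0 : (0 : ℝ) < n := by linarith
    obtain ⟨hp0, hp1⟩ : 0 < p n ∧ p n ≤ 1 := edgeProb_mem hβ0 n (by omega)
    have hs0 : 0 < s n := Real.rpow_pos_of_pos hn0 _
    have hδ0 : 0 < δ n := Real.rpow_pos_of_pos hE0 _
    have hδE : δ n ^ 4 * E n = 1 := by
      rw [hδ, ← Real.rpow_natCast, ← Real.rpow_mul hE0.le]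
      norm_num [Real.rpow_neg_one, hE0.ne']
    have hps : p n * s n = 1 / s n := by
      rw [eq_div_iff hs0.ne', mul_assoc]
      simp only [hp, hs]
      rw [← Real.rpow_add hn0, ← Real.rpow_add hn0]
      norm_num
    have hqE : (n * p n) ^ 2 ≤ 4 * E n * p n := by
      have : E n = n * (n - 1) / 2 * p n := expEdges_eq n (p n)
      rw [this]
      have hpp : 0 < p n ^ 2 := by positivity
      nlinarith [mul_pos hpp hn0]
    set Z : SimpleGraph (Fin n) → ℝ := fun G =>
      1 / (δ n * E n) ^ 2 * ((G.edgeSet.ncard : ℝ) - E n) ^ 2 +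
        ∑ m ∈ Finset.Icc 3 (2 * k), 1 / ((n * p n) ^ m * s n) * (basedCycleCount G m : ℝ) with hZ
    have hcoef : ∀ m : ℕ, 0 < (n * p n) ^ m * s n := fun m => by positivity
    have hterm : ∀ G : SimpleGraph (Fin n), ∀ m : ℕ,
        0 ≤ 1 / ((n * p n) ^ m * s n) * (basedCycleCount G m : ℝ) := fun G m =>
      mul_nonneg (one_div_nonneg.2 (hcoef m).le) (Nat.cast_nonneg _)
    have hZ0 : ∀ G, 0 ≤ Z G := fun G =>
      add_nonneg (by positivity) (Finset.sum_nonneg fun m _ => hterm G m)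
    have hEZ : erExp n (p n) Z ≤ δ n ^ 2 + 2 * k / s n := by
      rw [hZ, erExp_add, erExp_const_mul, erExp_sum]
      refine add_le_add ?_ ?_
      · calc _ ≤ 1 / (δ n * E n) ^ 2 * E n :=
              mul_le_mul_of_nonneg_left (erExp_edge_deviation_sq_le n (p n) hp0.le)
                (by positivity)
          _ = δ n ^ 2 := by
              field_simp
              linarith
      · have hb : ∀ m ∈ Finset.Icc 3 (2 * k), erExp n (p n)
            (fun G => 1 / ((n * p n) ^ m * s n) * (basedCycleCount G m : ℝ)) ≤ 1 / s n := by
          intro m hm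
          have hm3 := (Finset.mem_Icc.1 hm).1
          rw [erExp_const_mul]
          calc _ ≤ 1 / ((n * p n) ^ m * s n) * (n * p n) ^ m :=
                mul_le_mul_of_nonneg_left (erExp_basedCycleCount_le hp0.le m (by omega))
                  (one_div_nonneg.2 (hcoef m).le)
            _ = 1 / s n := by field_simp
        refine (Finset.sum_le_card_nsmul _ _ _ hb).trans ?_
        rw [nsmul_eq_mul, Nat.card_Icc, mul_one_div]
        gcongr
        have : 2 * k + 1 - 3 ≤ 2 * k := by omega
        exact_mod_cast this
    refine le_trans (by linarith) (one_sub_erExp_le_erProb hp0.le hp1 hZ0 ?_)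
    intro G hG ℓ hℓ hℓk
    have hdev : 1 / (δ n * E n) ^ 2 * ((G.edgeSet.ncard : ℝ) - E n) ^ 2 < 1 :=
      lt_of_le_of_lt (le_add_of_nonneg_right (Finset.sum_nonneg fun m _ => hterm G m)) hG
    have hcyc : ∀ m, 3 ≤ m → m ≤ 2 * k → (basedCycleCount G m : ℝ) ≤ (n * p n) ^ m * s n := by
      intro m hm3 hmk
      have h1 : 1 / ((n * p n) ^ m * s n) * (basedCycleCount G m : ℝ) < 1 :=
        lt_of_le_of_lt ((Finset.single_le_sum (fun m _ => hterm G m)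
          (Finset.mem_Icc.2 ⟨hm3, hmk⟩)).trans (le_add_of_nonneg_left (by positivity))) hG
      rw [one_div_mul_eq_div, div_lt_one (hcoef m)] at h1
      exact h1.le
    have habs : |(G.edgeSet.ncard : ℝ) - E n| ≤ δ n * E n := by
      rw [one_div_mul_eq_div, div_lt_one (by positivity)] at hdev
      exact abs_le_of_sq_le_sq hdev.le (by positivity)
    obtain ⟨hl, hu⟩ := abs_le.1 habs
    obtain ⟨hup, hlow⟩ := hall ℓ (Finset.mem_Icc.2 ⟨hℓ, hℓk⟩)
    have hscale : 0 ≤ (2 * E n) ^ ℓ / (ℓ.factorial : ℝ) := by positivity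
    have hℓk' : (ℓ : ℝ) ≤ k := by exact_mod_cast hℓk
    refine ⟨(mul_le_mul_of_nonneg_right hlow hscale).trans ?_,
      (numFaces_le_of_edges G (elt n) (by linarith) ℓ).trans
        (mul_le_mul_of_nonneg_right hup hscale)⟩
    exact le_numFaces_of_edges hℓ hℓk G (elt n) hE0 hs0 hp0.le hp1 hps hq hqE (by linarith)
      (by linarith) (by linarith) hcyc (by nlinarith)
  · filter_upwards [eventually_ge_atTop 1] with n hn
    obtain ⟨hp0, hp1⟩ := edgeProb_mem hβ0 n hn
    exact erProb_le_one hp0.le hp1 _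

lemma tendsto_erProb_mono {β : ℝ} (hβ0 : 0 < β) {A B : ∀ n : ℕ, Set (SimpleGraph (Fin n))}
    (hA : Tendsto (fun n => erProb n ((n : ℝ) ^ (-β)) (A n)) atTop (nhds 1))
    (hAB : ∀ᶠ n in atTop, A n ⊆ B n) :
    Tendsto (fun n => erProb n ((n : ℝ) ^ (-β)) (B n)) atTop (nhds 1) := by
  refine tendsto_of_tendsto_of_tendsto_of_le_of_le' hA tendsto_const_nhds ?_ ?_
  · filter_upwards [hAB, eventually_ge_atTop 1] with n h hn
    obtain ⟨hp0, hp1⟩ := edgeProb_mem hβ0 n hn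
    exact erProb_mono hp0.le hp1 h
  · filter_upwards [eventually_ge_atTop 1] with n hn
    obtain ⟨hp0, hp1⟩ := edgeProb_mem hβ0 n hn
    exact erProb_le_one hp0.le hp1 _

lemma realChoose_le_pow_div {x : ℝ} {ℓ : ℕ} (h : (ℓ : ℝ) ≤ x) :
    realChoose x ℓ ≤ x ^ ℓ / (ℓ.factorial : ℝ) := by
  rw [realChoose]
  gcongr
  calc _ ≤ ∏ _i ∈ Finset.range ℓ, x := by
        refine Finset.prod_le_prod (fun i hi => ?_) (fun i _ => ?_)
        · have : (i : ℝ) ≤ ℓ := by exact_mod_cast (Finset.mem_range.1 hi).le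
          linarith
        · have : (0 : ℝ) ≤ i := Nat.cast_nonneg i
          linarith
    _ = x ^ ℓ := by rw [Finset.prod_const, Finset.card_range]

/-- `binom(x, ℓ)` is asymptotically at least `x ^ ℓ / ℓ!`. -/
lemma eventually_mul_pow_div_le_realChoose (ℓ : ℕ) {c : ℝ} (hc : c < 1) :
    ∀ᶠ x in atTop, c * (x ^ ℓ / (ℓ.factorial : ℝ)) ≤ realChoose x ℓ := by
  have h : Tendsto (fun x : ℝ => ∏ i ∈ Finset.range ℓ, (1 - (i : ℝ) / x)) atTop
      (nhds (∏ i ∈ Finset.range ℓ, (1 - 0))) :=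
    tendsto_finsetProd _ fun i _ => (tendsto_id.const_div_atTop (i : ℝ)).const_sub 1
  simp only [sub_zero, Finset.prod_const_one] at h
  filter_upwards [h.eventually_const_le hc, eventually_gt_atTop 0] with x hx hx0
  have e : realChoose x ℓ =
      (∏ i ∈ Finset.range ℓ, (1 - (i : ℝ) / x)) * (x ^ ℓ / (ℓ.factorial : ℝ)) := by
    rw [realChoose, ← mul_div_assoc]
    congr 1
    rw [← Finset.card_range ℓ, ← Finset.prod_const, Finset.card_range, ← Finset.prod_mul_distrib]
    refine Finset.prod_congr rfl fun i _ => ?_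
    field_simp
  rw [e]
  exact mul_le_mul_of_nonneg_right hx (by positivity)

end Asymptotics

open Filter in
theorem stmt16 (β : ℝ) (hβ0 : 0 < β) (hβ1 : β < 1) (k : ℕ) (hk : 1 ≤ k)
    (ε : ℝ) (hε : 0 < ε)
    (elt : ∀ n : ℕ, Sym2 (Fin n) → Sym2 (Fin n) → Prop)
    (hord : ∀ n, IsStrictTotalOrder (Sym2 (Fin n)) (elt n)) :
    (∃ B₀ > (0 : ℝ), ∀ B ≥ B₀,
      Tendsto (fun n => erProb n ((n : ℝ) ^ (-β))
          {G | ∀ ℓ, 1 ≤ ℓ → ℓ ≤ k →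
            (2 : ℝ) ^ ((ℓ : ℝ) - ε) * realChoose (expEdges n ((n : ℝ) ^ (-β))) ℓ -
                B * (expEdges n ((n : ℝ) ^ (-β))) ^ ((ℓ : ℝ) - min (1 / 2) (β / (2 - β))) ≤
                (numFaces G (elt n) ℓ : ℝ) ∧
              (numFaces G (elt n) ℓ : ℝ) ≤
                (2 : ℝ) ^ ((ℓ : ℝ) + ε) * realChoose (expEdges n ((n : ℝ) ^ (-β))) ℓ})
        atTop (nhds 1)) ∧
    (∃ c C : ℝ, 0 < c ∧ c < C ∧
      Tendsto (fun n => erProb n ((n : ℝ) ^ (-β))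
          {G | ∀ ℓ, 1 ≤ ℓ → ℓ ≤ k →
            c * (n : ℝ) ^ ((2 - β) * ℓ) ≤ (numFaces G (elt n) ℓ : ℝ) ∧
              (numFaces G (elt n) ℓ : ℝ) ≤ C * (n : ℝ) ^ ((2 - β) * ℓ)})
        atTop (nhds 1)) := by
  have hElim := tendsto_expEdges hβ1
  constructor
  · refine ⟨1, one_pos, fun B hB => ?_⟩
    have h2ε : 1 < (2 : ℝ) ^ ε := Real.one_lt_rpow one_lt_two hε
    have h2ε' : (2 : ℝ) ^ (-ε) < 1 := Real.rpow_lt_one_of_one_lt_of_neg one_lt_two (by linarith)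
    obtain ⟨η, hη0, hη⟩ : ∃ η : ℝ, 0 < η ∧ 1 + η < 2 ^ ε ∧ (2 : ℝ) ^ (-ε) < 1 - η := by
      obtain ⟨η, h0, h1⟩ := exists_between
        (lt_min (sub_pos.2 h2ε) (sub_pos.2 h2ε'))
      exact ⟨η, h0, by linarith [lt_min_iff.1 h1], by linarith [lt_min_iff.1 h1]⟩
    refine tendsto_erProb_mono hβ0 (tendsto_erProb_numFaces_near hβ0 hβ1 k elt hη0) ?_
    have hc : (1 + η) / 2 ^ ε < 1 := (div_lt_one (by linarith)).2 hη.1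
    have hall := (Filter.eventually_all_finset (Finset.Icc 1 k)).2
      fun ℓ _ => hElim.eventually (eventually_mul_pow_div_le_realChoose ℓ hc)
    filter_upwards [hall, hElim.eventually_ge_atTop (k : ℝ), hElim.eventually_gt_atTop 0]
      with n hall hkE hE0 G hG ℓ hℓ hℓk
    obtain ⟨hlow, hup⟩ := hG ℓ hℓ hℓk
    have hch := hall ℓ (Finset.mem_Icc.2 ⟨hℓ, hℓk⟩)
    set E := expEdges n ((n : ℝ) ^ (-β)) with hE
    have hℓE : (ℓ : ℝ) ≤ E := le_trans (by exact_mod_cast hℓk) hkE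
    have hscale : 0 ≤ E ^ ℓ / (ℓ.factorial : ℝ) := by positivity
    have hpull : (2 * E) ^ ℓ / (ℓ.factorial : ℝ) = 2 ^ ℓ * (E ^ ℓ / (ℓ.factorial : ℝ)) := by
      rw [mul_pow, mul_div_assoc]
    rw [hpull] at hlow hup
    constructor
    · have hB0 : 0 ≤ B * E ^ ((ℓ : ℝ) - min (1 / 2) (β / (2 - β))) :=
        mul_nonneg (by linarith) (Real.rpow_nonneg hE0.le _)
      refine le_trans (sub_le_self _ hB0) (le_trans ?_ hlow)
      rw [sub_eq_add_neg, Real.rpow_add two_pos, Real.rpow_natCast]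
      calc (2 : ℝ) ^ ℓ * 2 ^ (-ε) * realChoose E ℓ
          ≤ 2 ^ ℓ * (1 - η) * (E ^ ℓ / (ℓ.factorial : ℝ)) := by
            have h1 := realChoose_le_pow_div hℓE
            have h2 := hη.2.le
            calc _ ≤ (2 : ℝ) ^ ℓ * 2 ^ (-ε) * (E ^ ℓ / (ℓ.factorial : ℝ)) := by gcongr
              _ ≤ _ := by gcongr
        _ = _ := by ring
    · refine hup.trans ?_
      rw [Real.rpow_add two_pos, Real.rpow_natCast]
      have h3 : (1 + η) * (E ^ ℓ / (ℓ.factorial : ℝ)) ≤ 2 ^ ε * realChoose E ℓ := by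
        rw [div_mul_eq_mul_div, div_le_iff₀ (by linarith)] at hch
        linarith
      calc (1 + η) * (2 ^ ℓ * (E ^ ℓ / (ℓ.factorial : ℝ)))
          = 2 ^ ℓ * ((1 + η) * (E ^ ℓ / (ℓ.factorial : ℝ))) := by ring
        _ ≤ 2 ^ ℓ * (2 ^ ε * realChoose E ℓ) := by gcongr
        _ = _ := by ring
  · have hfac : (0 : ℝ) < k.factorial := Nat.cast_pos.2 k.factorial_pos
    have hc1 : (1 / 2) * ((1 / 2) ^ k / (k.factorial : ℝ)) ≤ 1 / 2 := by
      have h1 : (1 : ℝ) ≤ k.factorial := by exact_mod_cast k.factorial_pos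
      have h2 : ((1 : ℝ) / 2) ^ k ≤ 1 := pow_le_one₀ (by norm_num) (by norm_num)
      have : ((1 : ℝ) / 2) ^ k / (k.factorial : ℝ) ≤ 1 := (div_le_one hfac).2 (h2.trans h1)
      linarith
    refine ⟨(1 / 2) * ((1 / 2) ^ k / (k.factorial : ℝ)), 3 / 2, by positivity, by linarith,
      tendsto_erProb_mono hβ0
        (tendsto_erProb_numFaces_near hβ0 hβ1 k elt (one_half_pos (α := ℝ))) ?_⟩
    filter_upwards [eventually_ge_atTop 2, hElim.eventually_gt_atTop 0] with n hn hE0 G hG ℓ hℓ hℓk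
    obtain ⟨hlow, hup⟩ := hG ℓ hℓ hℓk
    obtain ⟨hEl, hEu⟩ := expEdges_bounds (β := β) hn
    set E := expEdges n ((n : ℝ) ^ (-β)) with hE
    have hn0 : (0 : ℝ) < n := by
      have : 0 < n := by omega
      exact_mod_cast this
    rw [Real.rpow_mul hn0.le, Real.rpow_natCast]
    set N := (n : ℝ) ^ (2 - β) with hN
    have hN0 : 0 < N := Real.rpow_pos_of_pos hn0 _
    have hf1 : (1 : ℝ) ≤ ℓ.factorial := by exact_mod_cast ℓ.factorial_pos
    constructor
    · refine le_trans ?_ hlow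
      calc 1 / 2 * ((1 / 2) ^ k / (k.factorial : ℝ)) * N ^ ℓ
          ≤ 1 / 2 * ((1 / 2) ^ ℓ / (ℓ.factorial : ℝ)) * N ^ ℓ := by
            have h1 : ((1 : ℝ) / 2) ^ k ≤ (1 / 2) ^ ℓ :=
              pow_le_pow_of_le_one (by norm_num) (by norm_num) hℓk
            have h2 : (ℓ.factorial : ℝ) ≤ k.factorial := by
              exact_mod_cast Nat.factorial_le hℓk
            gcongr
        _ = (1 - 1 / 2) * ((N / 2) ^ ℓ / (ℓ.factorial : ℝ)) := by
            rw [div_pow, div_pow, one_pow]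
            ring
        _ ≤ _ := by
            have : N / 2 ≤ 2 * E := by linarith
            gcongr
    · refine hup.trans ?_
      have h1 : (2 * E) ^ ℓ / (ℓ.factorial : ℝ) ≤ N ^ ℓ := by
        refine (div_le_self (by positivity) hf1).trans ?_
        have : 2 * E ≤ N := by linarith
        gcongr
      linarith

end SEP
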